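/- arXiv:2402.15382 — 3 statements merged into one kernel-verified Lean document; each statement's English description precedes it below -/
import Mathlib

section
/- (Soundness) If φ is a theorem of J_n.lin, then φ is valid in every hereditarily linear J_n-frame: for every valuation and every world w of the frame, w ⊩ φ. -/
/-- Formulas of the polymodal language `L_{[<ω]}`: propositional variables,
a constant ⊤, Boolean connectives, and a modality `[m]` for each `m : ℕ`. -/
inductive Formula : Type
  | var : ℕ → Formula
  | top : Formula
  | neg : Formula → Formula
  | and : Formula → Formula → Formula
  | or : Formula → Formula → Formula
  | imp : Formula → Formula → Formula
  | box : ℕ → Formula → Formula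
  deriving DecidableEq

namespace Formula

/-- `⊥` abbreviates `¬⊤`. -/
def bot : Formula := neg top

/-- `⟨m⟩φ` abbreviates `¬[m]¬φ`. -/
def dia (m : ℕ) (φ : Formula) : Formula := neg (box m (neg φ))

/-- A formula is closed if it contains no propositional variables. -/
def Closed : Formula → Prop
  | var _ => False
  | top => True
  | neg a => Closed a
  | and a b => Closed a ∧ Closed b
  | or a b => Closed a ∧ Closed b
  | imp a b => Closed a ∧ Closed b
  | box _ a => Closed a

/-- Membership in the language `L_{[<n]}`: all modalities `[m]` have `m < n`. -/
def InLang (n : ℕ) : Formula → Prop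
  | var _ => True
  | top => True
  | neg a => InLang n a
  | and a b => InLang n a ∧ InLang n b
  | or a b => InLang n a ∧ InLang n b
  | imp a b => InLang n a ∧ InLang n b
  | box m a => m < n ∧ InLang n a

/-- Uniform substitution of formulas for propositional variables. -/
def subst (σ : ℕ → Formula) : Formula → Formula
  | var i => σ i
  | top => top
  | neg a => neg (subst σ a)
  | and a b => and (subst σ a) (subst σ b)
  | or a b => or (subst σ a) (subst σ b)
  | imp a b => imp (subst σ a) (subst σ b)
  | box m a => box m (subst σ a)

/-- The number of occurrences of modal operators in a formula
(diamonds `⟨m⟩` are abbreviations `¬[m]¬`, so each is one box occurrence). -/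
def modalCount : Formula → ℕ
  | var _ => 0
  | top => 0
  | neg a => modalCount a
  | and a b => modalCount a + modalCount b
  | or a b => modalCount a + modalCount b
  | imp a b => modalCount a + modalCount b
  | box _ a => modalCount a + 1

end Formula

/-- Conjunction of a finite list of formulas. -/
def bigConj (l : List Formula) : Formula := l.foldr Formula.and Formula.top

/-- `⋀_{m ≤ k < n} [k]φ`. -/
def boxConj (m n : ℕ) (φ : Formula) : Formula :=
  bigConj ((List.range' m (n - m)).map fun k => Formula.box k φ)

/-- The pseudo-linearity axiom
`[m]((⋀_{m≤k<n}[k]φ) → ψ) ∨ [m]((⋀_{m≤k<n}[k]ψ ∧ ψ) → φ)`. -/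
def psLin (n m : ℕ) (φ ψ : Formula) : Formula :=
  Formula.or
    (Formula.box m (Formula.imp (boxConj m n φ) ψ))
    (Formula.box m (Formula.imp (Formula.and (boxConj m n ψ) ψ) φ))

/-- A Boolean valuation of formulas respecting the Boolean connectives
(treating boxed formulas and variables as atoms). -/
def RespectsBool (v : Formula → Bool) : Prop :=
  v Formula.top = true ∧
  (∀ a, v (Formula.neg a) = !(v a)) ∧
  (∀ a b, v (Formula.and a b) = (v a && v b)) ∧
  (∀ a b, v (Formula.or a b) = (v a || v b)) ∧
  (∀ a b, v (Formula.imp a b) = (!(v a) || v b))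

/-- Propositional tautologies of the modal language. -/
def Tautology (φ : Formula) : Prop :=
  ∀ v : Formula → Bool, RespectsBool v → v φ = true

/-- Japaridze's polymodal provability logic `GLP`. -/
inductive GLP : Formula → Prop
  | taut {φ : Formula} : Tautology φ → GLP φ
  | distr (m : ℕ) (φ ψ : Formula) :
      GLP (Formula.imp (Formula.box m (Formula.imp φ ψ))
        (Formula.imp (Formula.box m φ) (Formula.box m ψ)))
  | lob (m : ℕ) (φ : Formula) :
      GLP (Formula.imp (Formula.box m (Formula.imp (Formula.box m φ) φ)) (Formula.box m φ))
  | mono (m : ℕ) (φ : Formula) :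
      GLP (Formula.imp (Formula.box m φ) (Formula.box (m + 1) φ))
  | diaMono (m : ℕ) (φ : Formula) :
      GLP (Formula.imp (Formula.dia m φ) (Formula.box (m + 1) (Formula.dia m φ)))
  | mp {φ ψ : Formula} : GLP (Formula.imp φ ψ) → GLP φ → GLP ψ
  | nec (m : ℕ) {φ : Formula} : GLP φ → GLP (Formula.box m φ)

/-- The logic `GLP.3`: `GLP` together with the linearity axioms
`[m]([m]A → B) ∨ [m]([m]B ∧ B → A)`. -/
inductive GLP3 : Formula → Prop
  | taut {φ : Formula} : Tautology φ → GLP3 φ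
  | distr (m : ℕ) (φ ψ : Formula) :
      GLP3 (Formula.imp (Formula.box m (Formula.imp φ ψ))
        (Formula.imp (Formula.box m φ) (Formula.box m ψ)))
  | lob (m : ℕ) (φ : Formula) :
      GLP3 (Formula.imp (Formula.box m (Formula.imp (Formula.box m φ) φ)) (Formula.box m φ))
  | mono (m : ℕ) (φ : Formula) :
      GLP3 (Formula.imp (Formula.box m φ) (Formula.box (m + 1) φ))
  | diaMono (m : ℕ) (φ : Formula) :
      GLP3 (Formula.imp (Formula.dia m φ) (Formula.box (m + 1) (Formula.dia m φ)))
  | lin (m : ℕ) (A B : Formula) :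
      GLP3 (Formula.or (Formula.box m (Formula.imp (Formula.box m A) B))
        (Formula.box m (Formula.imp (Formula.and (Formula.box m B) B) A)))
  | mp {φ ψ : Formula} : GLP3 (Formula.imp φ ψ) → GLP3 φ → GLP3 ψ
  | nec (m : ℕ) {φ : Formula} : GLP3 φ → GLP3 (Formula.box m φ)

/-- The logic `GLP_n`, i.e. `GLP` restricted to the language `L_{[<n]}`. -/
inductive GLPn (n : ℕ) : Formula → Prop
  | taut {φ : Formula} : Tautology φ → Formula.InLang n φ → GLPn n φ
  | distr {m : ℕ} (hm : m < n) (φ ψ : Formula)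
      (hφ : Formula.InLang n φ) (hψ : Formula.InLang n ψ) :
      GLPn n (Formula.imp (Formula.box m (Formula.imp φ ψ))
        (Formula.imp (Formula.box m φ) (Formula.box m ψ)))
  | lob {m : ℕ} (hm : m < n) (φ : Formula) (hφ : Formula.InLang n φ) :
      GLPn n (Formula.imp (Formula.box m (Formula.imp (Formula.box m φ) φ)) (Formula.box m φ))
  | mono {m : ℕ} (hm : m + 1 < n) (φ : Formula) (hφ : Formula.InLang n φ) :
      GLPn n (Formula.imp (Formula.box m φ) (Formula.box (m + 1) φ))
  | diaMono {m : ℕ} (hm : m + 1 < n) (φ : Formula) (hφ : Formula.InLang n φ) :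
      GLPn n (Formula.imp (Formula.dia m φ) (Formula.box (m + 1) (Formula.dia m φ)))
  | mp {φ ψ : Formula} : GLPn n (Formula.imp φ ψ) → GLPn n φ → GLPn n ψ
  | nec {m : ℕ} (hm : m < n) {φ : Formula} : GLPn n φ → GLPn n (Formula.box m φ)

/-- The logic `GLP_n.3`: `GLP_n` with the linearity axioms for each `m < n`. -/
inductive GLPn3 (n : ℕ) : Formula → Prop
  | taut {φ : Formula} : Tautology φ → Formula.InLang n φ → GLPn3 n φ
  | distr {m : ℕ} (hm : m < n) (φ ψ : Formula)
      (hφ : Formula.InLang n φ) (hψ : Formula.InLang n ψ) :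
      GLPn3 n (Formula.imp (Formula.box m (Formula.imp φ ψ))
        (Formula.imp (Formula.box m φ) (Formula.box m ψ)))
  | lob {m : ℕ} (hm : m < n) (φ : Formula) (hφ : Formula.InLang n φ) :
      GLPn3 n (Formula.imp (Formula.box m (Formula.imp (Formula.box m φ) φ)) (Formula.box m φ))
  | mono {m : ℕ} (hm : m + 1 < n) (φ : Formula) (hφ : Formula.InLang n φ) :
      GLPn3 n (Formula.imp (Formula.box m φ) (Formula.box (m + 1) φ))
  | diaMono {m : ℕ} (hm : m + 1 < n) (φ : Formula) (hφ : Formula.InLang n φ) :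
      GLPn3 n (Formula.imp (Formula.dia m φ) (Formula.box (m + 1) (Formula.dia m φ)))
  | lin {m : ℕ} (hm : m < n) (A B : Formula)
      (hA : Formula.InLang n A) (hB : Formula.InLang n B) :
      GLPn3 n (Formula.or (Formula.box m (Formula.imp (Formula.box m A) B))
        (Formula.box m (Formula.imp (Formula.and (Formula.box m B) B) A)))
  | mp {φ ψ : Formula} : GLPn3 n (Formula.imp φ ψ) → GLPn3 n φ → GLPn3 n ψ
  | nec {m : ℕ} (hm : m < n) {φ : Formula} : GLPn3 n φ → GLPn3 n (Formula.box m φ)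

/-- Beklemishev's logic `J_n`. -/
inductive Jn (n : ℕ) : Formula → Prop
  | taut {φ : Formula} : Tautology φ → Formula.InLang n φ → Jn n φ
  | distr {k : ℕ} (hk : k < n) (φ ψ : Formula)
      (hφ : Formula.InLang n φ) (hψ : Formula.InLang n ψ) :
      Jn n (Formula.imp (Formula.box k (Formula.imp φ ψ))
        (Formula.imp (Formula.box k φ) (Formula.box k ψ)))
  | lob {k : ℕ} (hk : k < n) (φ : Formula) (hφ : Formula.InLang n φ) :
      Jn n (Formula.imp (Formula.box k (Formula.imp (Formula.box k φ) φ)) (Formula.box k φ))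
  | trans1 {k m : ℕ} (hkm : k ≤ m) (hm : m < n) (φ : Formula) (hφ : Formula.InLang n φ) :
      Jn n (Formula.imp (Formula.box k φ) (Formula.box k (Formula.box m φ)))
  | trans2 {k m : ℕ} (hkm : k ≤ m) (hm : m < n) (φ : Formula) (hφ : Formula.InLang n φ) :
      Jn n (Formula.imp (Formula.box k φ) (Formula.box m (Formula.box k φ)))
  | diaMono {k m : ℕ} (hkm : k < m) (hm : m < n) (φ : Formula) (hφ : Formula.InLang n φ) :
      Jn n (Formula.imp (Formula.dia k φ) (Formula.box m (Formula.dia k φ)))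
  | mp {φ ψ : Formula} : Jn n (Formula.imp φ ψ) → Jn n φ → Jn n ψ
  | nec {k : ℕ} (hk : k < n) {φ : Formula} : Jn n φ → Jn n (Formula.box k φ)

/-- The logic `J_n.lin`: `J_n` together with the pseudo-linearity axioms. -/
inductive JnLin (n : ℕ) : Formula → Prop
  | taut {φ : Formula} : Tautology φ → Formula.InLang n φ → JnLin n φ
  | distr {k : ℕ} (hk : k < n) (φ ψ : Formula)
      (hφ : Formula.InLang n φ) (hψ : Formula.InLang n ψ) :
      JnLin n (Formula.imp (Formula.box k (Formula.imp φ ψ))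
        (Formula.imp (Formula.box k φ) (Formula.box k ψ)))
  | lob {k : ℕ} (hk : k < n) (φ : Formula) (hφ : Formula.InLang n φ) :
      JnLin n (Formula.imp (Formula.box k (Formula.imp (Formula.box k φ) φ)) (Formula.box k φ))
  | trans1 {k m : ℕ} (hkm : k ≤ m) (hm : m < n) (φ : Formula) (hφ : Formula.InLang n φ) :
      JnLin n (Formula.imp (Formula.box k φ) (Formula.box k (Formula.box m φ)))
  | trans2 {k m : ℕ} (hkm : k ≤ m) (hm : m < n) (φ : Formula) (hφ : Formula.InLang n φ) :
      JnLin n (Formula.imp (Formula.box k φ) (Formula.box m (Formula.box k φ)))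
  | diaMono {k m : ℕ} (hkm : k < m) (hm : m < n) (φ : Formula) (hφ : Formula.InLang n φ) :
      JnLin n (Formula.imp (Formula.dia k φ) (Formula.box m (Formula.dia k φ)))
  | lin {m : ℕ} (hm : m < n) (φ ψ : Formula)
      (hφ : Formula.InLang n φ) (hψ : Formula.InLang n ψ) :
      JnLin n (psLin n m φ ψ)
  | mp {φ ψ : Formula} : JnLin n (Formula.imp φ ψ) → JnLin n φ → JnLin n ψ
  | nec {k : ℕ} (hk : k < n) {φ : Formula} : JnLin n φ → JnLin n (Formula.box k φ)

section Frames

variable {T : Type*}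

/-- `(T, <_0, …, <_{n-1})` (encoded as `R : ℕ → T → T → Prop`, only the
relations `R i` for `i < n` being relevant) is a `J_n`-frame. -/
def IsJnFrame (n : ℕ) (R : ℕ → T → T → Prop) : Prop :=
  (∀ i < n, Irreflexive (R i)) ∧
  (∀ i < n, Transitive (R i)) ∧
  (∀ i < n, WellFounded fun a b => R i b a) ∧
  ∀ ⦃k m : ℕ⦄, k < m → m < n →
    (∀ ⦃x y z : T⦄, R m x y → R k y z → R k x z) ∧
    (∀ ⦃x y z : T⦄, R k x y → R m y z → R k x z) ∧
    (∀ ⦃x y z : T⦄, R k x z → R m y z → R k x y)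

/-- A frame is hereditarily linear if any two distinct points are comparable
by some relation `<_k`, `k < n`. -/
def HereditarilyLinear (n : ℕ) (R : ℕ → T → T → Prop) : Prop :=
  ∀ x y : T, x ≠ y → ∃ k < n, R k x y ∨ R k y x

/-- A frame is stratified if `x <_m y` and `z <_k y` imply `x <_m z` for `k < m < n`. -/
def Stratified (n : ℕ) (R : ℕ → T → T → Prop) : Prop :=
  ∀ ⦃k m : ℕ⦄, k < m → m < n → ∀ ⦃x y z : T⦄, R m x y → R k z y → R m x z

/-- The relations `≡_k` (for `k ≤ n`): `≡_n` is identity and `≡_k` is the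
equivalence relation generated by the union of `<_k` and `≡_{k+1}`.
Equivalence classes of `≡_k` are the `k`-planes. -/
def eqvRel (R : ℕ → T → T → Prop) (n : ℕ) (k : ℕ) : T → T → Prop :=
  if _ : k < n then
    Relation.EqvGen fun x y => R k x y ∨ eqvRel R n (k + 1) x y
  else Eq
termination_by n - k
decreasing_by omega

/-- Kripke satisfaction in the model `(T, R, V)`. -/
def Sat (R : ℕ → T → T → Prop) (V : ℕ → T → Prop) : T → Formula → Prop
  | w, Formula.var p => V p w
  | _, Formula.top => True
  | w, Formula.neg a => ¬ Sat R V w a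
  | w, Formula.and a b => Sat R V w a ∧ Sat R V w b
  | w, Formula.or a b => Sat R V w a ∨ Sat R V w b
  | w, Formula.imp a b => Sat R V w a → Sat R V w b
  | w, Formula.box m a => ∀ v : T, R m w v → Sat R V v a

end Frames

/-- A set of formulas is consistent with the logic `L` if no finite conjunction
of its elements has its negation provable in `L`. -/
def SetConsistent (L : Formula → Prop) (S : Set Formula) : Prop :=
  ∀ l : List Formula, (∀ φ ∈ l, φ ∈ S) → ¬ L (Formula.neg (bigConj l))

/-- A maximal `L`-consistent set of `L_{[<n]}`-formulas. -/
def MCS (L : Formula → Prop) (n : ℕ) (S : Set Formula) : Prop :=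
  (∀ φ ∈ S, Formula.InLang n φ) ∧ SetConsistent L S ∧
  ∀ S' : Set Formula, (∀ φ ∈ S', Formula.InLang n φ) → S ⊆ S' → S ≠ S' → ¬ SetConsistent L S'

/-- The canonical accessibility relation `x <_m y`. -/
def canonR (m : ℕ) (x y : Set Formula) : Prop :=
  (∀ ψ : Formula, Formula.box m ψ ∈ x → ψ ∈ y) ∧
  (∃ ψ : Formula, Formula.box m ψ ∈ y ∧ Formula.box m ψ ∉ x)

/-- A set of formulas is `k`-maximal if it contains `¬ψ ∧ ⋀_{k≤m<n}[m]ψ` for some `ψ`. -/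
def kMaximal (n k : ℕ) (S : Set Formula) : Prop :=
  ∃ ψ : Formula, Formula.and (Formula.neg ψ) (boxConj k n ψ) ∈ S

section Frames

variable {T : Type*} {n : ℕ} {R : ℕ → T → T → Prop}

lemma IsJnFrame.comp (hJ : IsJnFrame n R) {a b : ℕ} (ha : a < n) (hb : b < n) {x y z : T}
    (hxy : R a x y) (hyz : R b y z) : R (min a b) x z := by
  obtain ⟨-, htrans, -, hmix⟩ := hJ
  rcases lt_trichotomy a b with hab | rfl | hab
  · rw [min_eq_left hab.le]
    exact (hmix hab hb).2.1 hxy hyz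
  · rw [min_self]
    exact htrans a ha hxy hyz
  · rw [min_eq_right hab.le]
    exact (hmix hab ha).1 hxy hyz

/-- Distinct relations of a `J_n`-frame are disjoint. -/
lemma IsJnFrame.index_eq (hJ : IsJnFrame n R) {a b : ℕ} (ha : a < n) (hb : b < n) {x y : T}
    (h₁ : R a x y) (h₂ : R b x y) : a = b := by
  obtain ⟨hirr, -, -, hmix⟩ := hJ
  rcases lt_trichotomy a b with hab | hab | hab
  · exact (hirr a ha x ((hmix hab hb).2.2 h₁ h₂)).elim
  · exact hab
  · exact (hirr b hb x ((hmix hab ha).2.2 h₂ h₁)).elim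

/-- In a hereditarily linear `J_n`-frame, `x <_m y` and `x <_k z` imply `y <_k z` for `k < m`. -/
lemma IsJnFrame.rel_of_rel_of_lt (hJ : IsJnFrame n R) (hHL : HereditarilyLinear n R) {k m : ℕ}
    (hkm : k < m) (hm : m < n) {x y z : T} (hxy : R m x y) (hxz : R k x z) : R k y z := by
  have hk : k < n := hkm.trans hm
  have hne : y ≠ z := by
    rintro rfl
    exact hkm.ne (hJ.index_eq hk hm hxz hxy)
  obtain ⟨j, hj, hyz | hzy⟩ := hHL y z hne
  · have hmin := hJ.index_eq (by omega) hk (hJ.comp hm hj hxy hyz) hxz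
    obtain rfl : j = k := by omega
    exact hyz
  · have hmin := hJ.index_eq (by omega) hm (hJ.comp hk hj hxz hzy) hxy
    omega

/-- Two distinct `<_m`-successors of a point are comparable by some `<_j` with `m ≤ j`. -/
lemma IsJnFrame.exists_le_rel (hJ : IsJnFrame n R) (hHL : HereditarilyLinear n R) {m : ℕ}
    (hm : m < n) {x y z : T} (hxy : R m x y) (hxz : R m x z) (hne : y ≠ z) :
    ∃ j, m ≤ j ∧ j < n ∧ (R j y z ∨ R j z y) := by
  obtain ⟨j, hj, h⟩ := hHL y z hne
  refine ⟨j, ?_, hj, h⟩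
  rcases h with hyz | hzy
  · have := hJ.index_eq (by omega) hm (hJ.comp hm hj hxy hyz) hxz
    omega
  · have := hJ.index_eq (by omega) hm (hJ.comp hm hj hxz hzy) hxy
    omega

variable {V : ℕ → T → Prop}

lemma sat_bigConj {w : T} {l : List Formula} :
    Sat R V w (bigConj l) ↔ ∀ φ ∈ l, Sat R V w φ := by
  induction l with
  | nil => simp [bigConj, Sat]
  | cons a l ih =>
    rw [List.forall_mem_cons, ← ih]
    rfl

lemma sat_boxConj {w : T} {m : ℕ} {φ : Formula} :
    Sat R V w (boxConj m n φ) ↔ ∀ k, m ≤ k → k < n → ∀ v, R k w v → Sat R V v φ := by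
  simp only [boxConj, sat_bigConj, List.forall_mem_map, List.mem_range'_1, Sat]
  exact ⟨fun h k hmk hkn => h k ⟨hmk, by omega⟩, fun h k hk => h k hk.1 (by omega)⟩

lemma sat_dia {w : T} {m : ℕ} {φ : Formula} :
    Sat R V w (Formula.dia m φ) ↔ ∃ v, R m w v ∧ Sat R V v φ := by
  simp [Formula.dia, Sat]

lemma Tautology.sat {φ : Formula} (h : Tautology φ) (w : T) : Sat R V w φ := by
  classical
  refine of_decide_eq_true (h (fun ψ => decide (Sat R V w ψ)) ?_)
  refine ⟨?_, fun _ => ?_, fun _ _ => ?_, fun _ _ => ?_, fun _ _ => ?_⟩ <;>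
    rw [Bool.eq_iff_iff] <;> simp <;> simp [Sat, imp_iff_not_or]

lemma sat_lob {k : ℕ} (hwf : WellFounded fun a b => R k b a)
    (htrans : ∀ ⦃x y z⦄, R k x y → R k y z → R k x z) (φ : Formula) (w : T) :
    Sat R V w (Formula.imp (Formula.box k (Formula.imp (Formula.box k φ) φ))
      (Formula.box k φ)) := by
  intro h v
  induction v using hwf.induction with
  | _ v ih => exact fun hwv => h v hwv fun u hvu => ih u hvu (htrans hwv hvu)

lemma IsJnFrame.sat_psLin (hJ : IsJnFrame n R) (hHL : HereditarilyLinear n R) {m : ℕ}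
    (hm : m < n) (φ ψ : Formula) (w : T) : Sat R V w (psLin n m φ ψ) := by
  simp only [psLin, Sat, sat_boxConj]
  by_contra! ⟨⟨y, hwy, hyφ, hyψ⟩, z, hwz, ⟨hzψ, hz⟩, hzφ⟩
  have hne : y ≠ z := by
    rintro rfl
    exact hyψ hz
  obtain ⟨j, hmj, hj, h | h⟩ := hJ.exists_le_rel hHL hm hwy hwz hne
  · exact hzφ (hyφ j hmj hj z h)
  · exact hyψ (hzψ j hmj hj y h)

end Frames

/-- Soundness: every theorem of `J_n.lin` is valid in every hereditarily
linear `J_n`-frame, at every world and under every valuation. -/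
theorem jnlin_sound (n : ℕ) (φ : Formula) (h : JnLin n φ) {T : Type*}
    (R : ℕ → T → T → Prop) (hJ : IsJnFrame n R) (hHL : HereditarilyLinear n R)
    (V : ℕ → T → Prop) (w : T) :
    Sat R V w φ := by
  induction h generalizing w with
  | taut h _ => exact h.sat w
  | distr _ φ ψ _ _ => exact fun h₁ h₂ v hv => h₁ v hv (h₂ v hv)
  | lob hk φ _ => exact sat_lob (hJ.2.2.1 _ hk) (hJ.2.1 _ hk) φ w
  | trans1 hkm hm φ _ =>
    intro h v hwv u hvu
    have hwu := hJ.comp (hkm.trans_lt hm) hm hwv hvu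
    rw [min_eq_left hkm] at hwu
    exact h u hwu
  | trans2 hkm hm φ _ =>
    intro h v hwv u hvu
    have hwu := hJ.comp hm (hkm.trans_lt hm) hwv hvu
    rw [min_eq_right hkm] at hwu
    exact h u hwu
  | diaMono hkm hm φ _ =>
    intro h v hwv
    obtain ⟨u, hwu, hu⟩ := sat_dia.1 h
    exact sat_dia.2 ⟨u, hJ.rel_of_rel_of_lt hHL hkm hm hwv hwu, hu⟩
  | lin hm φ ψ _ _ => exact hJ.sat_psLin hHL hm φ ψ w
  | mp _ _ ih₁ ih₂ => exact ih₁ w (ih₂ w)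
  | nec _ _ ih => exact fun v _ => ih v
end

section
/- (Completeness) If an L_{[<n]}-formula φ is consistent with J_n.lin (i.e., ¬φ is not a theorem of J_n.lin), then there exist a finite hereditarily linear J_n-frame (T, <_0, …, <_{n-1}), a valuation on T, and a world w ∈ T such that w ⊩ φ. -/
namespace JnLin

/-- Replace every boxed subformula whose modality lies outside `L_{[<n]}` by `⊤`. -/
def restrict (n : ℕ) : Formula → Formula
  | .var i => .var i
  | .top => .top
  | .neg a => .neg (restrict n a)
  | .and a b => .and (restrict n a) (restrict n b)
  | .or a b => .or (restrict n a) (restrict n b)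
  | .imp a b => .imp (restrict n a) (restrict n b)
  | .box m a => if m < n then .box m (restrict n a) else .top

lemma inLang_restrict (n : ℕ) (a : Formula) : (restrict n a).InLang n := by
  induction a with
  | box m a ih =>
    unfold restrict
    split_ifs with h
    · exact ⟨h, ih⟩
    · trivial
  | _ => simp_all [restrict, Formula.InLang]

lemma restrict_of_inLang {n : ℕ} {a : Formula} (h : a.InLang n) : restrict n a = a := by
  induction a <;> simp_all [restrict, Formula.InLang]

lemma tautology_restrict (n : ℕ) {a : Formula} (h : Tautology a) : Tautology (restrict n a) := by
  rintro v ⟨h1, h2, h3, h4, h5⟩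
  exact h (fun b => v (restrict n b))
    ⟨by simpa [restrict] using h1, fun _ => by simp [restrict, h2], fun _ _ => by simp [restrict, h3],
      fun _ _ => by simp [restrict, h4], fun _ _ => by simp [restrict, h5]⟩

lemma restrict_bigConj (n : ℕ) (l : List Formula) :
    restrict n (bigConj l) = bigConj (l.map (restrict n)) := by
  induction l with
  | nil => rfl
  | cons a l ih =>
    change Formula.and (restrict n a) (restrict n (bigConj l)) = _
    rw [ih]; rfl

lemma restrict_boxConj (m n : ℕ) (a : Formula) :
    restrict n (boxConj m n a) = boxConj m n (restrict n a) := by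
  unfold boxConj
  rw [restrict_bigConj, List.map_map]
  congr 1
  refine List.map_congr_left fun k hk => ?_
  have : k < n := by
    rw [List.mem_range'] at hk
    omega
  simp [restrict, this]

/-- A Boolean valuation making every theorem of `J_n.lin` true; equivalently, a maximal
consistent set. -/
def IsWorld (n : ℕ) (v : Formula → Bool) : Prop :=
  RespectsBool v ∧ ∀ a, JnLin n (restrict n a) → v a = true

/-- The type of worlds of the canonical model of `J_n.lin`. -/
abbrev World (n : ℕ) := {v : Formula → Bool // IsWorld n v}

/-- Compactness of propositional logic. -/
lemma exists_valuation_of_finitely_satisfiable (G : Set Formula)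
    (h : ∀ l : List Formula, (∀ a ∈ l, a ∈ G) → ∃ v, RespectsBool v ∧ ∀ a ∈ l, v a = true) :
    ∃ v, RespectsBool v ∧ ∀ a ∈ G, v a = true := by
  have hev (a : Formula) : Continuous fun v : Formula → Bool => v a := continuous_apply a
  have hc : IsClosed {v : Formula → Bool | RespectsBool v} := by
    simp only [RespectsBool, Set.ofPred_and, Set.ofPred_forall]
    refine (isClosed_eq (hev _) continuous_const).inter (IsClosed.inter ?_ (IsClosed.inter ?_
      (IsClosed.inter ?_ ?_)))
    · exact isClosed_iInter fun a => isClosed_eq (hev _)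
        ((continuous_of_discreteTopology (f := fun b : Bool => !b)).comp (hev a))
    all_goals
      refine isClosed_iInter fun a => isClosed_iInter fun b => isClosed_eq (hev _) ?_
    · exact (continuous_of_discreteTopology (f := fun p : Bool × Bool => p.1 && p.2)).comp
        ((hev a).prodMk (hev b))
    · exact (continuous_of_discreteTopology (f := fun p : Bool × Bool => p.1 || p.2)).comp
        ((hev a).prodMk (hev b))
    · exact (continuous_of_discreteTopology (f := fun p : Bool × Bool => !p.1 || p.2)).comp
        ((hev a).prodMk (hev b))
  have key := hc.isCompact.inter_iInter_nonempty
    (fun a : G => {v : Formula → Bool | v a = true})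
    (fun a => isClosed_eq (hev _) continuous_const) ?_
  · obtain ⟨v, hv, hv'⟩ := key
    exact ⟨v, hv, fun a ha => Set.mem_iInter.1 hv' ⟨a, ha⟩⟩
  · intro u
    obtain ⟨v, hv, hv'⟩ := h (u.toList.map Subtype.val) (by simp +contextual)
    refine ⟨v, hv, ?_⟩
    simp only [Set.mem_iInter, Set.mem_ofPred_eq]
    exact fun i hi => hv' _ (List.mem_map.2 ⟨i, by simpa using hi, rfl⟩)

/-- A deductively closed set not containing `¬a` has a Boolean model satisfying `a`. -/
lemma exists_valuation_of_neg_notMem (G : Set Formula) (ht : ∀ a, Tautology a → a ∈ G)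
    (hmp : ∀ a b, Formula.imp a b ∈ G → a ∈ G → b ∈ G) (a : Formula) (ha : Formula.neg a ∉ G) :
    ∃ v, RespectsBool v ∧ (∀ b ∈ G, v b = true) ∧ v a = true := by
  have himp (l : List Formula) (hl : ∀ b ∈ l, b ∈ G) (c : Formula)
      (h : l.foldr Formula.imp c ∈ G) : c ∈ G := by
    induction l with
    | nil => exact h
    | cons b l ih =>
      exact ih (fun d hd => hl d (List.mem_cons_of_mem _ hd)) (hmp _ _ h (hl b List.mem_cons_self))
  have hval (v : Formula → Bool) (hv : RespectsBool v) (c : Formula) (l : List Formula)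
      (h : v (l.foldr Formula.imp c) = false) : (∀ b ∈ l, v b = true) ∧ v c = false := by
    induction l with
    | nil => simpa using h
    | cons b l ih =>
      rw [List.foldr_cons, hv.2.2.2.2] at h
      simp only [Bool.or_eq_false_iff, Bool.not_eq_false'] at h
      have := ih h.2
      simp_all
  suffices h : ∀ l : List Formula, (∀ b ∈ l, b ∈ insert a G) →
      ∃ v, RespectsBool v ∧ ∀ b ∈ l, v b = true by
    obtain ⟨v, hv, h⟩ := exists_valuation_of_finitely_satisfiable _ h
    exact ⟨v, hv, fun b hb => h b (Set.mem_insert_of_mem _ hb), h a (Set.mem_insert _ _)⟩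
  intro l hl
  by_contra! hcon
  refine ha (himp (l.filter (· ≠ a)) ?_ _ (ht _ fun v hv => ?_))
  · intro b hb
    rw [List.mem_filter] at hb
    exact (hl b hb.1).resolve_left (by simpa using hb.2)
  · by_contra hf
    obtain ⟨h1, h2⟩ := hval v hv _ _ (by simpa using hf)
    rw [hv.2.1] at h2
    obtain ⟨b, hb, hb'⟩ := hcon v hv
    by_cases hba : b = a
    · subst hba; simp_all
    · exact hb' (h1 b (List.mem_filter.2 ⟨hb, by simpa using hba⟩))

/-- Canonical accessibility. -/
def Acc {n : ℕ} (k : ℕ) (x y : World n) : Prop :=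
  ∀ a, x.1 (.box k a) = true → y.1 a = true

section Canonical

variable {n : ℕ}

lemma eval_neg (x : World n) (a : Formula) : x.1 (.neg a) = !(x.1 a) := x.2.1.2.1 a
lemma eval_and (x : World n) (a b : Formula) : x.1 (.and a b) = (x.1 a && x.1 b) :=
  x.2.1.2.2.1 a b
lemma eval_or (x : World n) (a b : Formula) : x.1 (.or a b) = (x.1 a || x.1 b) :=
  x.2.1.2.2.2.1 a b
lemma eval_imp (x : World n) (a b : Formula) : x.1 (.imp a b) = (!(x.1 a) || x.1 b) :=
  x.2.1.2.2.2.2 a b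

lemma mp_world (x : World n) {a b : Formula} (h : x.1 (.imp a b) = true) (ha : x.1 a = true) :
    x.1 b = true := by
  simpa [eval_imp, ha] using h

lemma box_of_theorem (x : World n) {k : ℕ} (hk : k < n) {a : Formula}
    (h : JnLin n (restrict n a)) : x.1 (.box k a) = true :=
  x.2.2 _ (by simpa [restrict, hk] using JnLin.nec hk h)

lemma box_mp (x : World n) {k : ℕ} (hk : k < n) {a b : Formula}
    (h : x.1 (.box k (.imp a b)) = true) (ha : x.1 (.box k a) = true) :
    x.1 (.box k b) = true := by
  refine mp_world x (mp_world x (x.2.2 _ ?_) h) ha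
  simpa [restrict, hk] using JnLin.distr hk _ _ (inLang_restrict n a) (inLang_restrict n b)

lemma box_of_tautology (x : World n) {k : ℕ} (hk : k < n) {a : Formula} (h : Tautology a) :
    x.1 (.box k a) = true :=
  box_of_theorem x hk (JnLin.taut (tautology_restrict n h) (inLang_restrict n a))

lemma box_mono (x : World n) {k : ℕ} (hk : k < n) {a b : Formula}
    (h : ∀ v, RespectsBool v → v a = true → v b = true) (ha : x.1 (.box k a) = true) :
    x.1 (.box k b) = true := by
  refine box_mp x hk (box_of_tautology x hk fun v hv => ?_) ha
  rw [hv.2.2.2.2]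
  have := h v hv
  cases hva : v a <;> simp_all

lemma box_box (x : World n) {k m : ℕ} (hkm : k ≤ m) (hm : m < n) {a : Formula}
    (h : x.1 (.box k a) = true) : x.1 (.box k (.box m a)) = true := by
  refine mp_world x (x.2.2 _ ?_) h
  simpa [restrict, hm, hkm.trans_lt hm] using JnLin.trans1 hkm hm _ (inLang_restrict n a)

lemma box_box_of_le (x : World n) {k m : ℕ} (hkm : k ≤ m) (hm : m < n) {a : Formula}
    (h : x.1 (.box k a) = true) : x.1 (.box m (.box k a)) = true := by
  refine mp_world x (x.2.2 _ ?_) h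
  simpa [restrict, hm, hkm.trans_lt hm] using JnLin.trans2 hkm hm _ (inLang_restrict n a)

lemma Acc.trans {i j : ℕ} (hi : i < n) (hj : j < n) {x y z : World n}
    (hxy : Acc i x y) (hyz : Acc j y z) : Acc (min i j) x z := by
  intro a ha
  rcases le_total i j with h | h
  · rw [min_eq_left h] at ha
    exact hyz _ (hxy _ (box_box x h hj ha))
  · rw [min_eq_right h] at ha
    exact hyz _ (hxy _ (box_box_of_le x h hi ha))

lemma Acc.box_iff {k m : ℕ} (hkm : k < m) (hm : m < n) {x y : World n} (h : Acc m x y)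
    (a : Formula) : y.1 (.box k a) = true ↔ x.1 (.box k a) = true := by
  have hk := hkm.trans hm
  refine ⟨fun ha => ?_, fun ha => h _ (box_box_of_le x hkm.le hm ha)⟩
  by_contra hx
  have hdia : x.1 (.dia k (.neg a)) = true := by
    rw [Formula.dia, eval_neg, Bool.not_eq_true', ← Bool.not_eq_true]
    exact fun h' => hx (box_mono x hk (fun v hv => by simp [hv.2.1]) h')
  have hy : y.1 (.dia k (.neg a)) = true := by
    refine h _ (mp_world x (x.2.2 _ ?_) hdia)
    simpa [restrict, Formula.dia, hm, hk] using
      JnLin.diaMono hkm hm _ (inLang_restrict n (.neg a))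
  rw [Formula.dia, eval_neg, box_mono y hk (fun v hv => by simp [hv.2.1]) ha] at hy
  simp at hy

/-- Every failing box is refuted at an accessible world where the same box holds. -/
lemma exists_acc (x : World n) {k : ℕ} (hk : k < n) {a : Formula}
    (h : x.1 (.box k a) = false) :
    ∃ y : World n, Acc k x y ∧ y.1 a = false ∧ y.1 (.box k a) = true := by
  obtain ⟨v, hv, hG, hva⟩ := exists_valuation_of_neg_notMem {b | x.1 (.box k b) = true}
    (fun b hb => box_of_tautology x hk hb) (fun b c => box_mp x hk)
    (.and (.neg a) (.box k a)) (fun hmem => by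
      have hl : x.1 (.box k (.imp (.box k a) a)) = true := by
        refine box_mono x hk (fun v hv => ?_) hmem
        rw [hv.2.1, hv.2.2.1, hv.2.1, hv.2.2.2.2]
        cases v a <;> simp
      have : x.1 (.box k a) = true := by
        refine mp_world x (x.2.2 _ ?_) hl
        simpa [restrict, hk] using JnLin.lob hk _ (inLang_restrict n a)
      simp [this] at h)
  rw [hv.2.2.1, hv.2.1] at hva
  simp only [Bool.and_eq_true, Bool.not_eq_true'] at hva
  exact ⟨⟨v, hv, fun b hb => hG b (box_of_theorem x hk hb)⟩, hG, hva.1, hva.2⟩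

lemma eval_boxConj (x : World n) (m : ℕ) (a : Formula)
    (h : ∀ j, m ≤ j → j < n → x.1 (.box j a) = true) : x.1 (boxConj m n a) = true := by
  have (l : List Formula) (hl : ∀ b ∈ l, x.1 b = true) : x.1 (bigConj l) = true := by
    induction l with
    | nil => exact x.2.1.1
    | cons b l ih =>
      change x.1 (.and b (bigConj l)) = true
      rw [eval_and, hl b List.mem_cons_self, ih fun c hc => hl c (List.mem_cons_of_mem _ hc)]
      rfl
  refine this _ fun b hb => ?_
  obtain ⟨j, hj, rfl⟩ := List.mem_map.1 hb
  rw [List.mem_range'] at hj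
  exact h j (by omega) (by omega)

lemma exists_common_box {m : ℕ} {y z : World n} (h : ∀ j, m ≤ j → j < n → ¬ Acc j y z) :
    ∃ a, (∀ j, m ≤ j → j < n → y.1 (.box j a) = true) ∧ z.1 a = false := by
  have (N : ℕ) : N ≤ n → ∃ a, (∀ j, m ≤ j → j < N → y.1 (.box j a) = true) ∧ z.1 a = false := by
    induction N with
    | zero =>
      intro _
      exact ⟨.neg .top, by simp, by simp [eval_neg, z.2.1.1]⟩
    | succ N ih =>
      intro hN
      obtain ⟨a, ha, haz⟩ := ih (by omega)
      by_cases hm : m ≤ N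
      · have hb := h N hm (by omega)
        simp only [Acc, not_forall] at hb
        obtain ⟨b, hb, hbz⟩ := hb
        refine ⟨.or a b, fun j hj hjN => ?_, by simp_all [eval_or]⟩
        rcases Nat.lt_succ_iff_lt_or_eq.1 hjN with hlt | rfl
        · exact box_mono y (by omega) (fun v hv hva => by simp [hv.2.2.2.1, hva]) (ha j hj hlt)
        · exact box_mono y (by omega) (fun v hv hva => by simp [hv.2.2.2.1, hva]) hb
      · exact ⟨a, fun j hj hjN => by omega, haz⟩
  exact this n le_rfl

/-- Any two worlds accessible by the same relation are equal or comparable. -/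
lemma Acc.linear {m : ℕ} (hm : m < n) {x y z : World n} (hy : Acc m x y) (hz : Acc m x z) :
    y = z ∨ ∃ j, m ≤ j ∧ j < n ∧ (Acc j y z ∨ Acc j z y) := by
  by_contra! hcon
  obtain ⟨hne, hacc⟩ := hcon
  obtain ⟨a, ha, haz⟩ := exists_common_box fun j hj hjn => (hacc j hj hjn).1
  obtain ⟨b, hb, hby⟩ := exists_common_box fun j hj hjn => (hacc j hj hjn).2
  obtain ⟨c, hcz, hcy⟩ : ∃ c, z.1 c = true ∧ y.1 c = false := by
    have : ∃ c, y.1 c ≠ z.1 c := by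
      by_contra! h
      exact hne (Subtype.ext (funext h))
    obtain ⟨c, hc⟩ := this
    cases hyc : y.1 c with
    | false => exact ⟨c, by simp_all, hyc⟩
    | true => exact ⟨.neg c, by simp_all [eval_neg], by simp [eval_neg, hyc]⟩
  have hax : x.1 (psLin n m a (.or b c)) = true := by
    refine x.2.2 _ ?_
    simpa [psLin, restrict, restrict_boxConj, hm] using
      JnLin.lin hm _ _ (inLang_restrict n a) (inLang_restrict n (.or b c))
  rw [psLin, eval_or, Bool.or_eq_true] at hax
  rcases hax with h | h
  · have := mp_world y (hy _ h) (eval_boxConj y m a ha)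
    simp [eval_or, hby, hcy] at this
  · have hand : z.1 (.and (boxConj m n (.or b c)) (.or b c)) = true := by
      rw [eval_and, eval_or, hcz, eval_boxConj z m _ fun j hj hjn => box_mono z hjn
        (fun v hv hva => by simp [hv.2.2.2.1, hva]) (hb j hj hjn)]
      simp
    have := mp_world z (hz _ h) hand
    simp [haz] at this

/-- Among the `k`-successors of `x` refuting the bodies in `F` there is a first one. -/
lemma exists_first_acc (x : World n) {k : ℕ} (hk : k < n) (F : Finset Formula)
    (hF : F.Nonempty) (h : ∀ a ∈ F, x.1 (.box k a) = false) :
    ∃ y : World n, Acc k x y ∧ (∃ a ∈ F, y.1 (.box k a) = true) ∧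
      ∀ a ∈ F, y.1 a = false ∨ ∃ j, k ≤ j ∧ j < n ∧ y.1 (.box j a) = false := by
  have hbox {i : ℕ} {u v : World n} {a : Formula} (huv : Acc i u v) (hv : v.1 a = false) :
      u.1 (.box i a) = false := by
    by_contra hu
    simp [huv a (by simpa using hu)] at hv
  induction hF using Finset.Nonempty.cons_induction with
  | singleton a =>
    obtain ⟨y, hxy, hya, hyb⟩ := exists_acc x hk (h a (by simp))
    exact ⟨y, hxy, ⟨a, by simp, hyb⟩, by simp [hya]⟩
  | cons a F haF hF ih =>
    obtain ⟨y, hxy, ⟨b, hbF, hyb⟩, hy⟩ := ih fun b hb => h b (Finset.mem_cons_of_mem hb)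
    obtain ⟨z, hxz, hza, hzb⟩ := exists_acc x hk (h a (Finset.mem_cons_self a F))
    rcases Acc.linear hk hxy hxz with rfl | ⟨j, hkj, hjn, hyz | hzy⟩
    · refine ⟨y, hxy, ⟨b, Finset.mem_cons_of_mem hbF, hyb⟩, fun c hc => ?_⟩
      rcases Finset.mem_cons.1 hc with rfl | hc
      exacts [.inl hza, hy c hc]
    · refine ⟨y, hxy, ⟨b, Finset.mem_cons_of_mem hbF, hyb⟩, fun c hc => ?_⟩
      rcases Finset.mem_cons.1 hc with rfl | hc
      exacts [.inr ⟨j, hkj, hjn, hbox hyz hza⟩, hy c hc]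
    · refine ⟨z, hxz, ⟨a, Finset.mem_cons_self a F, hzb⟩, fun c hc => ?_⟩
      rcases Finset.mem_cons.1 hc with rfl | hc
      · exact .inl hza
      · right
        rcases hy c hc with hyc | ⟨i, hki, hin, hyc⟩
        · exact ⟨j, hkj, hjn, hbox hzy hyc⟩
        · obtain ⟨u, hyu, huc, -⟩ := exists_acc y hin hyc
          exact ⟨min j i, le_min hkj hki, by omega, hbox (hzy.trans hjn hin hyu) huc⟩

end Canonical

/-- Place a frame below another one, all cross edges being labelled `k`. -/
def sumRel {S T : Type} (k : ℕ) (Q : ℕ → S → S → Prop) (R : ℕ → T → T → Prop) (i : ℕ) :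
    S ⊕ T → S ⊕ T → Prop
  | .inl a, .inl b => Q i a b
  | .inl _, .inr _ => i = k
  | .inr _, .inl _ => False
  | .inr a, .inr b => R i a b

lemma isJnFrame_sumRel {S T : Type} [Finite S] [Finite T] {n k : ℕ} {Q : ℕ → S → S → Prop}
    {R : ℕ → T → T → Prop} (hQ : IsJnFrame n Q) (hR : IsJnFrame n R)
    (hQk : ∀ i a b, Q i a b → k < i) (hRk : ∀ i a b, R i a b → k ≤ i) :
    IsJnFrame n (sumRel k Q R) := by
  obtain ⟨hQ1, hQ2, -, hQ4⟩ := hQ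
  obtain ⟨hR1, hR2, -, hR4⟩ := hR
  have hirr : ∀ i < n, Irreflexive (sumRel k Q R i) := by
    rintro i hi (a | a) h
    exacts [hQ1 i hi a h, hR1 i hi a h]
  have htr : ∀ i < n, Transitive (sumRel k Q R i) := by
    rintro i hi (a | a) (b | b) (c | c) h1 h2 <;> simp only [sumRel] at h1 h2 ⊢ <;>
      first
      | assumption
      | exact hQ2 i hi h1 h2
      | exact hR2 i hi h1 h2
  refine ⟨hirr, htr, fun i hi => ?_, fun j m hjm hm => ⟨?_, ?_, ?_⟩⟩
  · have : IsTrans (S ⊕ T) fun a b => sumRel k Q R i b a := ⟨fun a b c h1 h2 => htr i hi h2 h1⟩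
    have : Std.Irrefl fun a b => sumRel k Q R i b a := ⟨hirr i hi⟩
    exact Finite.wellFounded_of_trans_of_irrefl _
  · rintro (a | a) (b | b) (c | c) h1 h2 <;> simp only [sumRel] at h1 h2 ⊢ <;>
      first
      | assumption
      | exact (hQ4 hjm hm).1 h1 h2
      | exact (hR4 hjm hm).1 h1 h2
      | (have := hRk _ _ _ h2; omega)
  · rintro (a | a) (b | b) (c | c) h1 h2 <;> simp only [sumRel] at h1 h2 ⊢ <;>
      first
      | assumption
      | exact (hQ4 hjm hm).2.1 h1 h2
      | exact (hR4 hjm hm).2.1 h1 h2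
      | (have := hQk _ _ _ h1; omega)
  · rintro (a | a) (b | b) (c | c) h1 h2 <;> simp only [sumRel] at h1 h2 ⊢ <;>
      first
      | assumption
      | omega
      | (have := hRk _ _ _ h1; omega)
      | exact (hQ4 hjm hm).2.2 h1 h2
      | exact (hR4 hjm hm).2.2 h1 h2

/-- A finite hereditarily linear `J_n`-frame with edges labelled in `[k, n)`, mapped into the
canonical model with root `x`, in which every `[i]a` with `a ∈ D` and `i ≥ k` that fails is
refuted. -/
def Realizable (n : ℕ) (D : Finset Formula) (k : ℕ) (x : World n) : Prop :=
  ∃ (T : Type) (_ : Fintype T) (R : ℕ → T → T → Prop) (f : T → World n) (r : T),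
    f r = x ∧ IsJnFrame n R ∧ HereditarilyLinear n R ∧
    (∀ i a b, R i a b → k ≤ i ∧ i < n ∧ Acc i (f a) (f b)) ∧
    (∀ t, t = r ∨ ∃ i, R i r t) ∧
    ∀ t i, k ≤ i → i < n → ∀ a ∈ D, (f t).1 (.box i a) = false →
      ∃ s, R i t s ∧ (f s).1 a = false

section Realization

variable {n : ℕ} {D : Finset Formula}

lemma realizable_self (x : World n) : Realizable n D n x := by
  refine ⟨Unit, inferInstance, fun _ _ _ => False, fun _ => x, (), rfl, ⟨?_, ?_, ?_, ?_⟩, ?_, ?_,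
    ?_, ?_⟩
  · exact fun _ _ _ h => h
  · exact fun _ _ _ _ _ h _ => h
  · exact fun _ _ => ⟨fun _ => ⟨_, fun _ h => h.elim⟩⟩
  · exact fun _ _ _ _ => ⟨fun _ _ _ h _ => h, fun _ _ _ h _ => h, fun _ _ _ h _ => h⟩
  · exact fun _ _ h => (h rfl).elim
  · exact fun _ _ _ h => h.elim
  · exact fun _ => .inl rfl
  · intro _ i h1 h2
    omega

lemma Realizable.of_no_defect {k : ℕ} {x : World n} (hr : Realizable n D (k + 1) x)
    (h : ∀ a ∈ D, x.1 (.box k a) = true) : Realizable n D k x := by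
  obtain ⟨T, hT, R, f, r, rfl, hJ, hL, hR, hroot, hD⟩ := hr
  refine ⟨T, hT, R, f, r, rfl, hJ, hL, fun i a b hab => ?_, hroot, fun t i hki hin a ha hf => ?_⟩
  · obtain ⟨h1, h2⟩ := hR i a b hab
    exact ⟨by omega, h2⟩
  · rcases hki.eq_or_lt with rfl | hlt
    · rcases hroot t with rfl | ⟨j, hj⟩
      · simp [h a ha] at hf
      · obtain ⟨h1, h2, h3⟩ := hR _ _ _ hj
        simp [(h3.box_iff h1 h2 a).2 (h a ha)] at hf
    · exact hD t i hlt hin a ha hf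

lemma Realizable.sum {k : ℕ} (hk : k < n) {x y : World n} (hx : Realizable n D (k + 1) x)
    (hy : Realizable n D k y) (hxy : Acc k x y)
    (h : ∀ a ∈ D, x.1 (.box k a) = false →
      y.1 a = false ∨ ∃ j, k ≤ j ∧ j < n ∧ y.1 (.box j a) = false) :
    Realizable n D k x := by
  obtain ⟨S, hS, Q, f, r, rfl, hQJ, hQL, hQ, hQroot, hQD⟩ := hx
  obtain ⟨T, hT, R, g, s, rfl, hRJ, hRL, hR, hRroot, hRD⟩ := hy
  have hplane (a : S) (b : Formula) :
      (f a).1 (.box k b) = true ↔ (f r).1 (.box k b) = true := by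
    rcases hQroot a with rfl | ⟨i, hi⟩
    · rfl
    · obtain ⟨h1, h2, h3⟩ := hQ _ _ _ hi
      exact h3.box_iff h1 h2 b
  have hcross (a : S) (b : T) : Acc k (f a) (g b) := by
    have hrb : Acc k (f r) (g b) := by
      rcases hRroot b with rfl | ⟨i, hi⟩
      · exact hxy
      · obtain ⟨h1, h2, h3⟩ := hR _ _ _ hi
        simpa [h1] using hxy.trans hk h2 h3
    exact fun c hc => hrb c ((hplane a c).1 hc)
  refine ⟨S ⊕ T, inferInstance, sumRel k Q R, Sum.elim f g, .inl r, rfl,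
    isJnFrame_sumRel hQJ hRJ (fun i a b hab => (hQ i a b hab).1)
      (fun i a b hab => (hR i a b hab).1), ?_, ?_, ?_, ?_⟩
  · rintro (a | a) (b | b) hab
    · exact hQL a b (by simpa using hab)
    · exact ⟨k, hk, .inl rfl⟩
    · exact ⟨k, hk, .inr rfl⟩
    · exact hRL a b (by simpa using hab)
  · rintro i (a | a) (b | b) hab
    · obtain ⟨h1, h2⟩ := hQ i a b hab
      exact ⟨by omega, h2⟩
    · obtain rfl : i = k := hab
      exact ⟨le_rfl, hk, hcross a b⟩
    · exact hab.elim
    · exact hR i a b hab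
  · rintro (a | a)
    · rcases hQroot a with rfl | ⟨i, hi⟩
      exacts [.inl rfl, .inr ⟨i, hi⟩]
    · exact .inr ⟨k, rfl⟩
  · rintro (t | t) i hki hin a ha hf
    · rcases hki.eq_or_lt with rfl | hlt
      · have hra : (f r).1 (.box k a) = false := by
          by_contra hne
          have := (hplane t a).2 (by simpa using hne)
          simp_all
        rcases h a ha hra with hs | ⟨j, hkj, hjn, hs⟩
        · exact ⟨.inr s, rfl, hs⟩
        · obtain ⟨u, -, hu⟩ := hRD s j hkj hjn a ha hs
          exact ⟨.inr u, rfl, hu⟩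
      · obtain ⟨u, hu, hua⟩ := hQD t i hlt hin a ha hf
        exact ⟨.inl u, hu, hua⟩
    · obtain ⟨u, hu, hua⟩ := hRD t i hki hin a ha hf
      exact ⟨.inr u, hu, hua⟩

lemma realizable {k : ℕ} (hk : k ≤ n) (x : World n) : Realizable n D k x := by
  induction hk using Nat.decreasingInduction generalizing x with
  | self => exact realizable_self x
  | of_succ k hk ih =>
    induction hc : (D.filter fun a => x.1 (.box k a) = false).card using Nat.strong_induction_on
      generalizing x with
    | _ c ihc =>
      rcases (D.filter fun a => x.1 (.box k a) = false).eq_empty_or_nonempty with he | hne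
      · refine (ih x).of_no_defect fun a ha => ?_
        simpa using Finset.filter_eq_empty_iff.1 he ha
      · obtain ⟨y, hxy, ⟨b, hb, hyb⟩, hy⟩ := exists_first_acc x hk _ hne
          fun a ha => (Finset.mem_filter.1 ha).2
        refine (ih x).sum hk (ihc _ ?_ y rfl) hxy
          fun a ha hxa => hy a (Finset.mem_filter.2 ⟨ha, hxa⟩)
        rw [← hc]
        refine Finset.card_lt_card (Finset.ssubset_iff_of_subset ?_ |>.2 ⟨b, hb, by simp [hyb]⟩)
        refine Finset.monotone_filter_right _ fun a _ hya => ?_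
        by_contra hxa
        have := hxy _ (box_box x le_rfl hk (by simpa using hxa))
        simp_all

end Realization

/-- The bodies of the boxed subformulas. -/
def boxBodies : Formula → Finset Formula
  | .var _ => ∅
  | .top => ∅
  | .neg a => boxBodies a
  | .and a b => boxBodies a ∪ boxBodies b
  | .or a b => boxBodies a ∪ boxBodies b
  | .imp a b => boxBodies a ∪ boxBodies b
  | .box _ a => insert a (boxBodies a)

lemma sat_iff {n : ℕ} {D : Finset Formula} {T : Type} {R : ℕ → T → T → Prop} {f : T → World n}
    (hR : ∀ i a b, R i a b → Acc i (f a) (f b))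
    (hD : ∀ t i, i < n → ∀ a ∈ D, (f t).1 (.box i a) = false → ∃ s, R i t s ∧ (f s).1 a = false)
    (a : Formula) (ha : a.InLang n) (haD : boxBodies a ⊆ D) (t : T) :
    Sat R (fun p s => (f s).1 (.var p) = true) t a ↔ (f t).1 a = true := by
  induction a generalizing t with
  | var p => rfl
  | top => exact ⟨fun _ => (f t).2.1.1, fun _ => trivial⟩
  | neg a ih => simp [Sat, ih ha haD, eval_neg]
  | and a b iha ihb =>
    rw [boxBodies, Finset.union_subset_iff] at haD
    simp [Sat, iha ha.1 haD.1, ihb ha.2 haD.2, eval_and]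
  | or a b iha ihb =>
    rw [boxBodies, Finset.union_subset_iff] at haD
    simp [Sat, iha ha.1 haD.1, ihb ha.2 haD.2, eval_or]
  | imp a b iha ihb =>
    rw [boxBodies, Finset.union_subset_iff] at haD
    simp only [Sat, iha ha.1 haD.1, ihb ha.2 haD.2, eval_imp]
    cases (f t).1 a <;> simp
  | box m a ih =>
    rw [boxBodies, Finset.insert_subset_iff] at haD
    simp only [Sat, ih ha.2 haD.2]
    refine ⟨fun h => ?_, fun h s hs => hR _ _ _ hs a h⟩
    by_contra hf
    obtain ⟨s, hs, hsa⟩ := hD t m ha.1 a haD.1 (by simpa using hf)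
    simp [h s hs] at hsa

lemma exists_world {n : ℕ} {a : Formula} (h : ¬ JnLin n (restrict n (.neg a))) :
    ∃ x : World n, x.1 a = true := by
  obtain ⟨v, hv, hG, hva⟩ := exists_valuation_of_neg_notMem {b | JnLin n (restrict n b)}
    (fun b hb => JnLin.taut (tautology_restrict n hb) (inLang_restrict n b))
    (fun _ _ hbc hb => JnLin.mp hbc hb) a h
  exact ⟨⟨v, hv, hG⟩, hva⟩

end JnLin

/-- Completeness: every `L_{[<n]}`-formula consistent with `J_n.lin` is
satisfied at some world of a finite hereditarily linear `J_n`-frame. -/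
theorem jnlin_complete (n : ℕ) (φ : Formula) (hφ : Formula.InLang n φ)
    (hcons : ¬ JnLin n (Formula.neg φ)) :
    ∃ (T : Type) (_ : Fintype T) (R : ℕ → T → T → Prop) (V : ℕ → T → Prop) (w : T),
      IsJnFrame n R ∧ HereditarilyLinear n R ∧ Sat R V w φ := by
  obtain ⟨x, hx⟩ := JnLin.exists_world (n := n) (a := φ)
    (by rwa [JnLin.restrict_of_inLang (a := .neg φ) hφ])
  obtain ⟨T, hT, R, f, r, rfl, hJ, hL, hR, -, hD⟩ :=
    JnLin.realizable (D := JnLin.boxBodies φ) (Nat.zero_le n) x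
  exact ⟨T, hT, R, _, r, hJ, hL, (JnLin.sat_iff (fun i a b h => (hR i a b h).2.2)
    (fun t i => hD t i (Nat.zero_le i)) φ hφ subset_rfl r).2 hx⟩
end

section
/- Let W be the set of all maximal J_n.lin-consistent sets of L_{[<n]}-formulas with the canonical relations <_m. Suppose k < m < n, x, y ∈ W, and x <_m y. Then for every formula ψ, [k]ψ ∈ x if and only if [k]ψ ∈ y. -/
theorem RespectsBool.bigConj_eq_true {v : Formula → Bool} (hv : RespectsBool v)
    (l : List Formula) : v (bigConj l) = true ↔ ∀ φ ∈ l, v φ = true := by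
  induction l with
  | nil => simpa [bigConj] using hv.1
  | cons a l ih =>
    have h : bigConj (a :: l) = Formula.and a (bigConj l) := rfl
    simp [h, hv.2.2.1, ih]

theorem inLang_bigConj {n : ℕ} {l : List Formula} :
    Formula.InLang n (bigConj l) ↔ ∀ φ ∈ l, Formula.InLang n φ := by
  induction l with
  | nil => simp [bigConj, Formula.InLang]
  | cons a l ih =>
    have h : bigConj (a :: l) = Formula.and a (bigConj l) := rfl
    simp [h, Formula.InLang, ih]

theorem JnLin.inLang {n : ℕ} {φ : Formula} (h : JnLin n φ) : Formula.InLang n φ := by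
  induction h with
  | taut _ h => exact h
  | distr hk φ ψ hφ hψ => simp [Formula.InLang, *]
  | lob hk φ hφ => simp [Formula.InLang, *]
  | trans1 hkm hm φ hφ => simp [Formula.InLang, hkm.trans_lt hm, *]
  | trans2 hkm hm φ hφ => simp [Formula.InLang, hkm.trans_lt hm, *]
  | diaMono hkm hm φ hφ => simp [Formula.dia, Formula.InLang, hkm.trans hm, *]
  | lin hm φ ψ hφ hψ =>
    simp only [psLin, boxConj, Formula.InLang, inLang_bigConj, List.mem_map, List.mem_range'_1]
    refine ⟨⟨hm, ?_, hψ⟩, hm, ⟨?_, hψ⟩, hφ⟩ <;>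
    · rintro _ ⟨j, hj, rfl⟩
      exact ⟨by omega, by assumption⟩
  | mp _ _ ih _ => exact ih.2
  | nec hk _ ih => exact ⟨hk, ih⟩

/-- Provability in `J_n.lin` is closed under tautological consequence from one premise. -/
theorem JnLin.of_taut {n : ℕ} {φ ψ : Formula} (hφ : JnLin n φ) (hψ : Formula.InLang n ψ)
    (h : ∀ v, RespectsBool v → v φ = true → v ψ = true) : JnLin n ψ := by
  refine .mp (.taut (fun v hv => ?_) ⟨hφ.inLang, hψ⟩) hφ
  have := h v hv
  rw [hv.2.2.2.2]
  cases hb : v φ <;> simp_all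

/-- Provability in `J_n.lin` is closed under tautological consequence from two premises. -/
theorem JnLin.of_taut₂ {n : ℕ} {φ χ ψ : Formula} (hφ : JnLin n φ) (hχ : JnLin n χ)
    (hψ : Formula.InLang n ψ)
    (h : ∀ v, RespectsBool v → v φ = true → v χ = true → v ψ = true) : JnLin n ψ := by
  refine .mp (hφ.of_taut (ψ := .imp χ ψ) ⟨hχ.inLang, hψ⟩ fun v hv hvφ => ?_) hχ
  have := h v hv hvφ
  rw [hv.2.2.2.2]
  cases hb : v χ <;> simp_all

theorem JnLin.box_mono_s11 {n k : ℕ} (hk : k < n) {φ ψ : Formula} (h : JnLin n (.imp φ ψ)) :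
    JnLin n (.imp (.box k φ) (.box k ψ)) :=
  .mp (.distr hk φ ψ h.inLang.1 h.inLang.2) (.nec hk h)

namespace MCS

variable {n : ℕ} {S : Set Formula}

theorem exists_refutation (hS : MCS (JnLin n) n S) {φ : Formula}
    (hφ : Formula.InLang n φ) (h : φ ∉ S) :
    ∃ l : List Formula, (∀ χ ∈ l, χ ∈ S) ∧ JnLin n (.imp (bigConj l) (.neg φ)) := by
  have hinc := hS.2.2 (insert φ S)
    (by rintro χ (rfl | hχ); exacts [hφ, hS.1 χ hχ])
    (Set.subset_insert φ S) (fun he => h (he ▸ Set.mem_insert φ S))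
  simp only [SetConsistent, not_forall, not_not] at hinc
  obtain ⟨l, hl, hprov⟩ := hinc
  have hmem : ∀ χ ∈ l.filter (· ≠ φ), χ ∈ S := fun χ hχ => by
    simp only [List.mem_filter, decide_eq_true_eq] at hχ
    exact (hl χ hχ.1).resolve_left hχ.2
  refine ⟨l.filter (· ≠ φ), hmem, hprov.of_taut
    ⟨inLang_bigConj.2 fun χ hχ => hS.1 χ (hmem χ hχ), hφ⟩ fun v hv hvl => ?_⟩
  rw [hv.2.2.2.2, hv.2.1]
  rw [hv.2.1, Bool.not_eq_true', Bool.eq_false_iff, Ne, hv.bigConj_eq_true] at hvl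
  by_contra hcon
  simp only [Bool.or_eq_true, Bool.not_eq_true', not_or, Bool.not_eq_false,
    hv.bigConj_eq_true] at hcon
  refine hvl fun χ hχ => ?_
  by_cases he : χ = φ
  · exact he ▸ hcon.2
  · exact hcon.1 χ (by simp [hχ, he])

theorem mem_of_imp (hS : MCS (JnLin n) n S) {φ ψ : Formula} (hφ : φ ∈ S)
    (h : JnLin n (.imp φ ψ)) : ψ ∈ S := by
  by_contra hψ
  obtain ⟨l, hl, hprov⟩ := hS.exists_refutation h.inLang.2 hψ
  have hl' : ∀ χ ∈ φ :: l, χ ∈ S := by simpa [hφ] using hl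
  refine hS.2.1 _ hl' (hprov.of_taut₂ h (inLang_bigConj.2 fun χ hχ => hS.1 χ (hl' χ hχ)) ?_)
  intro v hv h₁ h₂
  change v (.neg (.and φ (bigConj l))) = true
  rw [hv.2.2.2.2] at h₁ h₂
  rw [hv.2.1] at h₁
  rw [hv.2.1, hv.2.2.1]
  grind

theorem neg_mem_of_notMem (hS : MCS (JnLin n) n S) {φ : Formula} (hφ : Formula.InLang n φ)
    (h : φ ∉ S) : Formula.neg φ ∈ S := by
  by_contra hneg
  obtain ⟨l₁, hl₁, hp₁⟩ := hS.exists_refutation hφ h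
  obtain ⟨l₂, hl₂, hp₂⟩ := hS.exists_refutation (φ := .neg φ) hφ hneg
  have hl : ∀ χ ∈ l₁ ++ l₂, χ ∈ S := fun χ hχ =>
    (List.mem_append.1 hχ).elim (hl₁ χ) (hl₂ χ)
  refine hS.2.1 _ hl (hp₁.of_taut₂ hp₂ (inLang_bigConj.2 fun χ hχ => hS.1 χ (hl χ hχ)) ?_)
  intro v hv h₁ h₂
  have happ : v (bigConj (l₁ ++ l₂)) = true →
      v (bigConj l₁) = true ∧ v (bigConj l₂) = true := by
    simp only [hv.bigConj_eq_true, List.forall_mem_append, imp_self]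
  rw [hv.2.2.2.2] at h₁ h₂
  rw [hv.2.1] at h₁ h₂ ⊢
  rw [hv.2.1] at h₂
  grind

theorem notMem_of_neg_mem (hS : MCS (JnLin n) n S) {φ : Formula} (h : Formula.neg φ ∈ S) :
    φ ∉ S := fun hφ => by
  have hl : ∀ χ ∈ [φ, .neg φ], χ ∈ S := by simp [hφ, h]
  refine hS.2.1 _ hl (.taut (fun v hv => ?_) (inLang_bigConj.2 fun χ hχ => hS.1 χ (hl χ hχ)))
  cases hb : v φ <;> simp [bigConj, hv.2.1, hv.2.2.1, hb]

end MCS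

/-- If `k < m < n` and `x <_m y` in the canonical model of `J_n.lin`, then for
every formula `ψ`, `[k]ψ ∈ x` iff `[k]ψ ∈ y`. -/
theorem canonical_lower_box_invariant (n m k : ℕ) (hkm : k < m) (hm : m < n)
    (x y : Set Formula) (hx : MCS (JnLin n) n x) (hy : MCS (JnLin n) n y)
    (hxy : canonR m x y) (ψ : Formula) :
    Formula.box k ψ ∈ x ↔ Formula.box k ψ ∈ y := by
  have hk : k < n := hkm.trans hm
  constructor
  · intro h
    exact hxy.1 _ (hx.mem_of_imp h (.trans2 hkm.le hm ψ (hx.1 _ h).2))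
  · intro h
    by_contra hnx
    have hψ : Formula.InLang n ψ := (hy.1 _ h).2
    have hnn : JnLin n (.imp (.neg (.neg ψ)) ψ) :=
      .taut (fun v hv => by simp [hv.2.1, hv.2.2.2.2]) ⟨hψ, hψ⟩
    have hnn' : JnLin n (.imp ψ (.neg (.neg ψ))) :=
      .taut (fun v hv => by simp [hv.2.1, hv.2.2.2.2]) ⟨hψ, hψ⟩
    have hdia : Formula.dia k (.neg ψ) ∈ x :=
      hx.neg_mem_of_notMem ⟨hk, hψ⟩ fun h' => hnx (hx.mem_of_imp h' (hnn.box_mono_s11 hk))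
    have hdia' : Formula.dia k (.neg ψ) ∈ y :=
      hxy.1 _ (hx.mem_of_imp hdia (.diaMono hkm hm (.neg ψ) hψ))
    exact hy.notMem_of_neg_mem hdia' (hy.mem_of_imp h (hnn'.box_mono_s11 hk))
end
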